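/- Let K and K' be non-degenerate CMIs, and let R_K^{K'} be 'K' conditioning on K'. Then: (1) if R_K^{K'} = (·,⟨⟩), K implies K' if and only if C ⊆ C'; (2) if R_K^{K'} ≠ (·,⟨⟩), K implies K' if and only if K implies R_K^{K'}. Here C and C' are the conditioning sets of can(pur(K)) and can(pur(K')). -/

import Mathlib

open scoped Classical

namespace Paper

variable {n : ℕ}

/-- The marginal distribution of the coordinates in `α` of a joint distribution `p` of
the discrete random variables `X_1, …, X_n` (each taking countably many values, coded
as natural numbers). -/
noncomputable def marginal (p : PMF (Fin n → ℕ)) (α : Finset (Fin n)) :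
    PMF ({ i // i ∈ α } → ℕ) :=
  p.map fun x i => x i.1

/-- The Shannon (joint) entropy `H(X_α)`. -/
noncomputable def Hm (p : PMF (Fin n → ℕ)) (α : Finset (Fin n)) : ℝ :=
  ∑' y, Real.negMulLog ((marginal p α) y).toReal

/-- The conditional entropy `H(X_β | X_α) = H(X_{β ∪ α}) - H(X_α)`. -/
noncomputable def Hc (p : PMF (Fin n → ℕ)) (β α : Finset (Fin n)) : ℝ :=
  Hm p (β ∪ α) - Hm p α

/-- Every individual random variable `X_i` has finite Shannon entropy
(the series defining `H(X_i)` is summable). -/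
def FiniteEntropy (p : PMF (Fin n → ℕ)) : Prop :=
  ∀ i : Fin n, Summable fun y : ℕ => Real.negMulLog ((p.map fun x => x i) y).toReal

/-- `J(X_{Q_1}, …, X_{Q_k} | X_C) = (∑ i, H(X_{Q_i}|X_C)) - H(X_{Q_1},…,X_{Q_k}|X_C)`;
the joint conditional entropy of the tuple `(X_{Q_1},…,X_{Q_k})` equals
`H(X_{∪ i, Q_i} | X_C)` since the two tuples determine each other. -/
noncomputable def J (p : PMF (Fin n → ℕ)) (C : Finset (Fin n))
    (Qs : Multiset (Finset (Fin n))) : ℝ :=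
  (Qs.map fun Q => Hc p Q C).sum - Hc p Qs.sup C

/-- A conditional mutual independency (CMI) on `{1, …, n}`: a conditioning set `C`
together with a finite multiset `⟨Q_1, …, Q_k⟩` of subsets of `{1, …, n}`. -/
structure CMI (n : ℕ) where
  C : Finset (Fin n)
  Qs : Multiset (Finset (Fin n))

/-- `K` is valid for the joint distribution `p`. -/
def Valid (p : PMF (Fin n → ℕ)) (K : CMI n) : Prop :=
  J p K.C K.Qs = 0

/-- `K` is degenerate: valid for every finite-entropy joint distribution. -/
def Degenerate (K : CMI n) : Prop :=
  ∀ p : PMF (Fin n → ℕ), FiniteEntropy p → Valid p K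

/-- `K ∼ K'`: valid for exactly the same finite-entropy joint distributions. -/
def Equivalent (K K' : CMI n) : Prop :=
  ∀ p : PMF (Fin n → ℕ), FiniteEntropy p → (Valid p K ↔ Valid p K')

/-- `K` implies `K'`. -/
def Implies (K K' : CMI n) : Prop :=
  ∀ p : PMF (Fin n → ℕ), FiniteEntropy p → Valid p K → Valid p K'

/-- `K` is in pure form: every `Q_i` is nonempty and disjoint from `C`. -/
def IsPure (K : CMI n) : Prop :=
  ∀ Q ∈ K.Qs, Q ≠ ∅ ∧ Q ∩ K.C = ∅

/-- The pure form `pur(K) = (C, ⟨Q_i \ C : Q_i \ C ≠ ∅⟩)`. -/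
noncomputable def pur (K : CMI n) : CMI n :=
  ⟨K.C, (K.Qs.map fun Q => Q \ K.C).filter fun Q => Q ≠ ∅⟩

/-- The set `𝕀_K` of repeated indices of `K`: indices lying in `Q_i ∩ Q_j` for two
distinct entries `i ≠ j` of the multiset (automatically `∅` when `k ≤ 1`). -/
noncomputable def repSet (K : CMI n) : Finset (Fin n) :=
  Finset.univ.filter fun q => 2 ≤ Multiset.card (K.Qs.filter fun Q => q ∈ Q)

/-- The multiset `⟨P_1, …, P_t⟩` of nonempty sets among the `Q_i \ 𝕀_K`. -/
noncomputable def parts (K : CMI n) : Multiset (Finset (Fin n)) :=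
  (K.Qs.map fun Q => Q \ repSet K).filter fun P => P ≠ ∅

/-- The multiset of the `P_j`-entries of the canonical form `can(K)`
(general notation). -/
noncomputable def canParts (K : CMI n) : Multiset (Finset (Fin n)) :=
  if Multiset.card K.Qs ≤ 1 then 0
  else if repSet K ≠ ∅ ∧ Multiset.card (parts K) ≤ 1 then 0
  else parts K

/-- The canonical form `can(K)` (of a pure-form CMI); all degenerate canonical forms
`(·,⟨⟩)` are represented by `⟨∅, 0⟩`. -/
noncomputable def can (K : CMI n) : CMI n :=
  if Multiset.card K.Qs ≤ 1 then ⟨∅, 0⟩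
  else if repSet K = ∅ then ⟨K.C, parts K⟩
  else if Multiset.card (parts K) ≤ 1 then ⟨K.C, {repSet K, repSet K}⟩
  else ⟨K.C, repSet K ::ₘ repSet K ::ₘ parts K⟩

/-- `R_K^{K'}`: the CMI "`K'` conditioning on `K`"; the degenerate case `(·,⟨⟩)` is
represented by `⟨∅, 0⟩`. -/
noncomputable def RCond (K K' : CMI n) : CMI n :=
  let I := repSet (pur K)
  let I' := repSet (pur K')
  let Ts := ((canParts (pur K')).map fun P => P \ I).filter fun T => T ≠ ∅
  if I' \ I = ∅ ∧ Multiset.card Ts ≤ 1 then ⟨∅, 0⟩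
  else if I' \ I = ∅ then ⟨K'.C \ I, Ts⟩
  else if Multiset.card Ts ≤ 1 then ⟨K'.C \ I, {I' \ I, I' \ I}⟩
  else ⟨K'.C \ I, (I' \ I) ::ₘ (I' \ I) ::ₘ Ts⟩


section Polymatroid

/-- A normalized, monotone and submodular set function. -/
structure IsPolymatroid (g : Finset (Fin n) → ℝ) : Prop where
  empty : g ∅ = 0
  mono : ∀ {A B : Finset (Fin n)}, A ⊆ B → g A ≤ g B
  submod : ∀ A B : Finset (Fin n), g (A ∪ B) + g (A ∩ B) ≤ g A + g B

/-- The total correlation `(∑ i, g Q_i) - g (⋃ i, Q_i)` with respect to a set function. -/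
def defect (g : Finset (Fin n) → ℝ) (Qs : Multiset (Finset (Fin n))) : ℝ :=
  (Qs.map g).sum - g Qs.sup

namespace IsPolymatroid

variable {g : Finset (Fin n) → ℝ}

lemma nonneg (hg : IsPolymatroid g) (A : Finset (Fin n)) : 0 ≤ g A :=
  hg.empty ▸ hg.mono (Finset.empty_subset A)

lemma union_le (hg : IsPolymatroid g) (A B : Finset (Fin n)) : g (A ∪ B) ≤ g A + g B := by
  linarith [hg.submod A B, hg.nonneg (A ∩ B)]

lemma sdiff_eq (hg : IsPolymatroid g) {I : Finset (Fin n)} (hI : g I = 0)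
    (Q : Finset (Fin n)) : g (Q \ I) = g Q := by
  refine le_antisymm (hg.mono Finset.sdiff_subset) ?_
  have h : g Q ≤ g (Q \ I ∪ I) := hg.mono (by
    rw [Finset.sdiff_union_self_eq_union]; exact Finset.subset_union_left)
  linarith [hg.union_le (Q \ I) I]

lemma sup_le_sum (hg : IsPolymatroid g) (Qs : Multiset (Finset (Fin n))) :
    g Qs.sup ≤ (Qs.map g).sum := by
  induction Qs using Multiset.induction_on with
  | empty => simp [hg.empty]
  | cons Q Qs ih =>
    rw [Multiset.sup_cons, Multiset.map_cons, Multiset.sum_cons, Finset.sup_eq_union]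
    linarith [hg.union_le Q Qs.sup]

lemma defect_nonneg (hg : IsPolymatroid g) (Qs : Multiset (Finset (Fin n))) :
    0 ≤ defect g Qs :=
  sub_nonneg.2 (hg.sup_le_sum Qs)

lemma defect_filter_sdiff (hg : IsPolymatroid g) {I : Finset (Fin n)} (hI : g I = 0)
    (Qs : Multiset (Finset (Fin n))) :
    defect g ((Qs.map fun Q => Q \ I).filter fun Q => Q ≠ ∅) = defect g Qs := by
  have hsum : (((Qs.map fun Q => Q \ I).filter fun Q => Q ≠ ∅).map g).sum = (Qs.map g).sum := by
    induction Qs using Multiset.induction_on with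
    | empty => simp
    | cons Q Qs ih =>
      rw [Multiset.map_cons, Multiset.map_cons, Multiset.sum_cons]
      by_cases h : Q \ I = ∅
      · rw [Multiset.filter_cons_of_neg (p := fun Q => Q ≠ ∅) _ (not_not.2 h), ih, ← hg.sdiff_eq hI Q, h, hg.empty,
          zero_add]
      · rw [Multiset.filter_cons_of_pos (p := fun Q => Q ≠ ∅) _ h, Multiset.map_cons, Multiset.sum_cons, ih,
          hg.sdiff_eq hI Q]
  have hsup : ((Qs.map fun Q => Q \ I).filter fun Q => Q ≠ ∅).sup = Qs.sup \ I := by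
    clear hsum
    induction Qs using Multiset.induction_on with
    | empty => simp
    | cons Q Qs ih =>
      rw [Multiset.map_cons, Multiset.sup_cons, Finset.sup_eq_union, Finset.union_sdiff_distrib]
      by_cases h : Q \ I = ∅
      · rw [Multiset.filter_cons_of_neg (p := fun Q => Q ≠ ∅) _ (not_not.2 h), ih, h, Finset.empty_union]
      · rw [Multiset.filter_cons_of_pos (p := fun Q => Q ≠ ∅) _ h, Multiset.sup_cons, ih, Finset.sup_eq_union]
  rw [defect, defect, hsum, hsup, hg.sdiff_eq hI]

lemma defect_zero (hg : IsPolymatroid g) : defect g 0 = 0 := by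
  simp [defect, hg.empty]

lemma defect_eq_zero_of_card_le_one (hg : IsPolymatroid g) {Qs : Multiset (Finset (Fin n))}
    (h : Multiset.card Qs ≤ 1) : defect g Qs = 0 := by
  rcases Nat.le_one_iff_eq_zero_or_eq_one.1 h with h | h
  · rw [Multiset.card_eq_zero.1 h, hg.defect_zero]
  · obtain ⟨Q, rfl⟩ := Multiset.card_eq_one.1 h
    simp [defect]

lemma eq_zero_of_singletons (hg : IsPolymatroid g) (I : Finset (Fin n))
    (h : ∀ q ∈ I, g {q} = 0) : g I = 0 := by
  induction I using Finset.induction_on with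
  | empty => exact hg.empty
  | insert q I _ ih =>
    have h₁ := ih fun r hr => h r (Finset.mem_insert_of_mem hr)
    have h₂ := h q (Finset.mem_insert_self q I)
    have h₃ := hg.union_le {q} I
    have h₄ := hg.nonneg (insert q I)
    rw [← Finset.insert_eq] at h₃
    linarith

lemma repSet_eq_zero (hg : IsPolymatroid g) (K : CMI n) (h : defect g K.Qs = 0) :
    g (repSet K) = 0 := by
  refine hg.eq_zero_of_singletons _ fun q hq => ?_
  have hq : 2 ≤ Multiset.card (K.Qs.filter fun Q => q ∈ Q) := (Finset.mem_filter.1 hq).2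
  obtain ⟨S, hS⟩ := Multiset.card_pos_iff_exists_mem.1
    ((Nat.choose_pos hq).trans_eq (Multiset.card_powersetCard 2 _).symm)
  obtain ⟨hS, hcard⟩ := Multiset.mem_powersetCard.1 hS
  obtain ⟨A, B, rfl⟩ := Multiset.card_eq_two.1 hcard
  have hA : q ∈ A := (Multiset.mem_filter.1 (Multiset.mem_of_le hS (by simp))).2
  have hB : q ∈ B := (Multiset.mem_filter.1 (Multiset.mem_of_le hS (by simp))).2
  obtain ⟨T, hT⟩ := Multiset.le_iff_exists_add.1 (hS.trans (Multiset.filter_le _ _))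
  rw [hT, defect, Multiset.map_add, Multiset.sum_add, Multiset.sup_add, Finset.sup_eq_union] at h
  have hAB : ({A, B} : Multiset (Finset (Fin n))).sup = A ∪ B := by
    simp [Multiset.insert_eq_cons]
  have hsum : (({A, B} : Multiset (Finset (Fin n))).map g).sum = g A + g B := by
    simp [Multiset.insert_eq_cons]
  rw [hAB, hsum] at h
  have h₁ := hg.union_le (A ∪ B) T.sup
  have h₂ := hg.sup_le_sum T
  have h₃ := hg.submod A B
  have h₄ : g {q} ≤ g (A ∩ B) := hg.mono (by simp [hA, hB])
  linarith [hg.nonneg {q}]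

lemma defect_eq_zero_iff_parts (hg : IsPolymatroid g) (K : CMI n) :
    defect g K.Qs = 0 ↔ g (repSet K) = 0 ∧ defect g (parts K) = 0 := by
  constructor
  · intro h
    have h₀ := hg.repSet_eq_zero K h
    exact ⟨h₀, (hg.defect_filter_sdiff h₀ K.Qs).trans h⟩
  · rintro ⟨h₀, h⟩
    exact (hg.defect_filter_sdiff h₀ K.Qs).symm.trans h

lemma defect_canParts (hg : IsPolymatroid g) (K : CMI n) :
    defect g (canParts K) = defect g (parts K) := by
  unfold canParts
  split_ifs with h₁ h₂
  · have h : Multiset.card (parts K) ≤ 1 :=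
      (Multiset.card_le_card (Multiset.filter_le _ _)).trans (by rwa [Multiset.card_map])
    rw [hg.defect_zero, hg.defect_eq_zero_of_card_le_one h]
  · rw [hg.defect_zero, hg.defect_eq_zero_of_card_le_one h₂.2]
  · rfl

lemma defect_cons_cons_eq_zero_iff (hg : IsPolymatroid g) (S : Finset (Fin n))
    (Ts : Multiset (Finset (Fin n))) :
    defect g (S ::ₘ S ::ₘ Ts) = 0 ↔ g S = 0 ∧ defect g Ts = 0 := by
  have h : defect g (S ::ₘ S ::ₘ Ts) = g S + g S + (Ts.map g).sum - g (S ∪ Ts.sup) := by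
    simp [defect, add_assoc]
  have h₁ := hg.union_le S Ts.sup
  have h₂ := hg.defect_nonneg Ts
  have h₃ := hg.nonneg S
  have h₄ : g Ts.sup ≤ g (S ∪ Ts.sup) := hg.mono Finset.subset_union_right
  rw [h]
  unfold defect at *
  constructor
  · intro h₅
    constructor <;> linarith
  · rintro ⟨h₅, h₆⟩
    linarith

end IsPolymatroid

end Polymatroid

section Entropy

/-- The Shannon entropy of the image of a distribution, as an expected information content. -/
lemma tsum_ofReal_negMulLog_map {Ω A : Type*} (p : PMF Ω) (F : Ω → A) :
    ∑' y, ENNReal.ofReal (Real.negMulLog ((p.map F) y).toReal) =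
      ∑' x, p x * ENNReal.ofReal (-Real.log ((p.map F) (F x)).toReal) := by
  have h (y : A) : ENNReal.ofReal (Real.negMulLog ((p.map F) y).toReal) =
      ∑' x, if y = F x then p x * ENNReal.ofReal (-Real.log ((p.map F) (F x)).toReal) else 0 := by
    rw [Real.negMulLog, neg_mul_comm, ENNReal.ofReal_mul ENNReal.toReal_nonneg,
      ENNReal.ofReal_toReal (PMF.apply_ne_top _ _)]
    conv_lhs => rw [PMF.map_apply, ← ENNReal.tsum_mul_right]
    refine tsum_congr fun x => ?_
    split_ifs with hy
    · rw [hy, ← PMF.map_apply]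
    · rw [zero_mul]
  simp_rw [h]
  rw [ENNReal.tsum_comm]
  exact tsum_congr fun x => tsum_ite_eq _ _

lemma negMulLog_prob_nonneg {A : Type*} (q : PMF A) (y : A) :
    0 ≤ Real.negMulLog (q y).toReal :=
  Real.negMulLog_nonneg ENNReal.toReal_nonneg
    (ENNReal.toReal_le_of_le_ofReal zero_le_one (by simpa using q.coe_le_one y))

lemma summable_negMulLog_map_iff {Ω A : Type*} (p : PMF Ω) (F : Ω → A) :
    (Summable fun y => Real.negMulLog ((p.map F) y).toReal) ↔
      ∑' x, p x * ENNReal.ofReal (-Real.log ((p.map F) (F x)).toReal) ≠ ⊤ := by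
  rw [← tsum_ofReal_negMulLog_map]
  refine ⟨fun h => h.tsum_ofReal_ne_top, fun h => ?_⟩
  refine (ENNReal.summable_toReal h).congr fun y => ?_
  exact ENNReal.toReal_ofReal (negMulLog_prob_nonneg _ y)

lemma tsum_negMulLog_map {Ω A : Type*} (p : PMF Ω) (F : Ω → A) :
    ∑' y, Real.negMulLog ((p.map F) y).toReal =
      (∑' x, p x * ENNReal.ofReal (-Real.log ((p.map F) (F x)).toReal)).toReal := by
  rw [← tsum_ofReal_negMulLog_map, ENNReal.tsum_toReal_eq fun _ => ENNReal.ofReal_ne_top]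
  exact tsum_congr fun y => (ENNReal.toReal_ofReal (negMulLog_prob_nonneg _ y)).symm

/-- The probability that the coordinates in `α` agree with those of `x`. -/
noncomputable def agreeProb (p : PMF (Fin n → ℕ)) (α : Finset (Fin n)) (x : Fin n → ℕ) :
    ENNReal :=
  ∑' y, if ∀ i ∈ α, x i = y i then p y else 0

lemma map_apply_eq_agreeProb {A : Type*} (p : PMF (Fin n → ℕ)) (α : Finset (Fin n))
    (F : (Fin n → ℕ) → A) (hF : ∀ x y, F x = F y ↔ ∀ i ∈ α, x i = y i) (x : Fin n → ℕ) :
    (p.map F) (F x) = agreeProb p α x := by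
  rw [PMF.map_apply, agreeProb]
  simp only [hF]

lemma restrict_eq_iff (α : Finset (Fin n)) (x y : Fin n → ℕ) :
    ((fun i : { i // i ∈ α } => x i.1) = fun i => y i.1) ↔ ∀ i ∈ α, x i = y i := by
  simp [funext_iff]

lemma le_agreeProb (p : PMF (Fin n → ℕ)) (α : Finset (Fin n)) (x : Fin n → ℕ) :
    p x ≤ agreeProb p α x := by
  refine le_trans ?_ (ENNReal.le_tsum x)
  simp

lemma agreeProb_anti (p : PMF (Fin n → ℕ)) {α β : Finset (Fin n)} (h : α ⊆ β)
    (x : Fin n → ℕ) : agreeProb p β x ≤ agreeProb p α x := by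
  refine ENNReal.tsum_le_tsum fun y => ?_
  split_ifs with h₁ h₂
  · exact le_rfl
  · exact absurd (fun i hi => h₁ i (h hi)) h₂
  · exact zero_le
  · exact le_rfl

lemma agreeProb_le_one (p : PMF (Fin n → ℕ)) (α : Finset (Fin n)) (x : Fin n → ℕ) :
    agreeProb p α x ≤ 1 := by
  rw [← p.tsum_coe]
  refine ENNReal.tsum_le_tsum fun y => ?_
  split_ifs
  · exact le_rfl
  · exact zero_le

lemma agreeProb_ne_top (p : PMF (Fin n → ℕ)) (α : Finset (Fin n)) (x : Fin n → ℕ) :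
    agreeProb p α x ≠ ⊤ :=
  ((agreeProb_le_one p α x).trans_lt ENNReal.one_lt_top).ne

lemma agreeProb_empty (p : PMF (Fin n → ℕ)) (x : Fin n → ℕ) : agreeProb p ∅ x = 1 := by
  simp [agreeProb, p.tsum_coe]

lemma agreeProb_congr (p : PMF (Fin n → ℕ)) {α : Finset (Fin n)} {x y : Fin n → ℕ}
    (h : ∀ i ∈ α, x i = y i) : agreeProb p α x = agreeProb p α y := by
  refine tsum_congr fun z => ?_
  have : (∀ i ∈ α, x i = z i) ↔ ∀ i ∈ α, y i = z i :=
    forall₂_congr fun i hi => by rw [h i hi]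
  simp only [this]

/-- The likelihood ratio `p_α p_β / (p_{α ∪ β} p_{α ∩ β})`. -/
noncomputable def ratio (p : PMF (Fin n → ℕ)) (α β : Finset (Fin n)) (x : Fin n → ℕ) :
    ENNReal :=
  agreeProb p α x * agreeProb p β x * (agreeProb p (α ∪ β) x)⁻¹ * (agreeProb p (α ∩ β) x)⁻¹

lemma sum_over_class_le (p : PMF (Fin n → ℕ)) (α β : Finset (Fin n)) (y z : Fin n → ℕ) :
    ∑' x, (if (∀ i ∈ α, x i = y i) ∧ ∀ i ∈ β, x i = z i then
      p x * (agreeProb p (α ∪ β) x)⁻¹ * (agreeProb p (α ∩ β) x)⁻¹ else 0) ≤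
      if ∀ i ∈ α ∩ β, y i = z i then (agreeProb p (α ∩ β) y)⁻¹ else 0 := by
  by_cases hex : ∃ w : Fin n → ℕ, (∀ i ∈ α, w i = y i) ∧ ∀ i ∈ β, w i = z i
  · obtain ⟨w, hy, hz⟩ := hex
    have hyz : ∀ i ∈ α ∩ β, y i = z i := fun i hi =>
      (hy i (Finset.mem_inter.1 hi).1).symm.trans (hz i (Finset.mem_inter.1 hi).2)
    rw [if_pos hyz]
    have hterm (x : Fin n → ℕ) :
        (if (∀ i ∈ α, x i = y i) ∧ ∀ i ∈ β, x i = z i then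
          p x * (agreeProb p (α ∪ β) x)⁻¹ * (agreeProb p (α ∩ β) x)⁻¹ else 0) =
        (if ∀ i ∈ α ∪ β, w i = x i then p x else 0) *
          ((agreeProb p (α ∪ β) w)⁻¹ * (agreeProb p (α ∩ β) y)⁻¹) := by
      have hiff : ((∀ i ∈ α, x i = y i) ∧ ∀ i ∈ β, x i = z i) ↔ ∀ i ∈ α ∪ β, w i = x i := by
        simp only [Finset.mem_union, or_imp, forall_and]
        refine and_congr (forall₂_congr fun i hi => ?_) (forall₂_congr fun i hi => ?_)
        · rw [hy i hi, eq_comm]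
        · rw [hz i hi, eq_comm]
      by_cases hx : ∀ i ∈ α ∪ β, w i = x i
      · rw [if_pos (hiff.2 hx), if_pos hx, agreeProb_congr p hx, mul_assoc]
        rw [agreeProb_congr p (α := α ∩ β) (x := x) (y := y)
          fun i hi => (hiff.2 hx).1 i (Finset.mem_inter.1 hi).1]
      · rw [if_neg (mt hiff.1 hx), if_neg hx, zero_mul]
    simp_rw [hterm]
    rw [ENNReal.tsum_mul_right, ← agreeProb, ← mul_assoc]
    exact mul_le_of_le_one_left zero_le (ENNReal.mul_inv_le_one _)
  · have : ∀ x : Fin n → ℕ, ¬ ((∀ i ∈ α, x i = y i) ∧ ∀ i ∈ β, x i = z i) :=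
      fun x hx => hex ⟨x, hx⟩
    simp [this]

lemma tsum_mul_ratio_le_one (p : PMF (Fin n → ℕ)) (α β : Finset (Fin n)) :
    ∑' x, p x * ratio p α β x ≤ 1 := by
  have hexpand (x : Fin n → ℕ) : p x * ratio p α β x = ∑' y, ∑' z, p y * (p z *
      (if (∀ i ∈ α, x i = y i) ∧ ∀ i ∈ β, x i = z i then
        p x * (agreeProb p (α ∪ β) x)⁻¹ * (agreeProb p (α ∩ β) x)⁻¹ else 0)) := by
    have : p x * ratio p α β x = agreeProb p α x * (agreeProb p β x *
        (p x * (agreeProb p (α ∪ β) x)⁻¹ * (agreeProb p (α ∩ β) x)⁻¹)) := by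
      rw [ratio]; ring
    rw [this]
    conv_lhs => rw [agreeProb, ← ENNReal.tsum_mul_right]
    refine tsum_congr fun y => ?_
    conv_lhs => rw [agreeProb, ← ENNReal.tsum_mul_right, ← ENNReal.tsum_mul_left]
    refine tsum_congr fun z => ?_
    by_cases h₁ : ∀ i ∈ α, x i = y i
    · by_cases h₂ : ∀ i ∈ β, x i = z i
      · rw [if_pos h₁, if_pos h₂, if_pos ⟨h₁, h₂⟩]
      · rw [if_neg h₂, if_neg (mt And.right h₂), zero_mul, mul_zero, mul_zero, mul_zero]
    · rw [if_neg h₁, if_neg (mt And.left h₁), zero_mul, mul_zero, mul_zero]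
  calc ∑' x, p x * ratio p α β x
      = ∑' y, ∑' z, p y * (p z * ∑' x,
          (if (∀ i ∈ α, x i = y i) ∧ ∀ i ∈ β, x i = z i then
            p x * (agreeProb p (α ∪ β) x)⁻¹ * (agreeProb p (α ∩ β) x)⁻¹ else 0)) := by
        simp_rw [hexpand]
        rw [ENNReal.tsum_comm]
        refine tsum_congr fun y => ?_
        rw [ENNReal.tsum_comm]
        refine tsum_congr fun z => ?_
        rw [ENNReal.tsum_mul_left, ENNReal.tsum_mul_left]
    _ ≤ ∑' y, ∑' z, p y * (p z *
          if ∀ i ∈ α ∩ β, y i = z i then (agreeProb p (α ∩ β) y)⁻¹ else 0) := by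
        gcongr with y z
        exact sum_over_class_le p α β y z
    _ = ∑' y, p y * (agreeProb p (α ∩ β) y * (agreeProb p (α ∩ β) y)⁻¹) := by
        refine tsum_congr fun y => ?_
        rw [ENNReal.tsum_mul_left]
        congr 1
        conv_rhs => rw [agreeProb, ← ENNReal.tsum_mul_right]
        refine tsum_congr fun z => ?_
        split_ifs <;> simp [agreeProb]
    _ ≤ ∑' y, p y := by
        gcongr with y
        exact mul_le_of_le_one_right zero_le (ENNReal.mul_inv_le_one _)
    _ = 1 := p.tsum_coe

/-- The information content of the coordinates in `α` at the point `x`. -/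
noncomputable def info (p : PMF (Fin n → ℕ)) (α : Finset (Fin n)) (x : Fin n → ℕ) : ℝ :=
  -Real.log (agreeProb p α x).toReal

lemma info_nonneg (p : PMF (Fin n → ℕ)) (α : Finset (Fin n)) (x : Fin n → ℕ) :
    0 ≤ info p α x :=
  neg_nonneg.2 (Real.log_nonpos ENNReal.toReal_nonneg
    (ENNReal.toReal_le_of_le_ofReal zero_le_one (by simpa using agreeProb_le_one p α x)))

lemma toReal_agreeProb_pos (p : PMF (Fin n → ℕ)) (α : Finset (Fin n)) {x : Fin n → ℕ}
    (hx : p x ≠ 0) : 0 < (agreeProb p α x).toReal :=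
  ENNReal.toReal_pos (fun h => hx (le_antisymm (h ▸ le_agreeProb p α x) zero_le))
    (agreeProb_ne_top p α x)

lemma mul_info_mono (p : PMF (Fin n → ℕ)) {α β : Finset (Fin n)} (h : α ⊆ β)
    (x : Fin n → ℕ) : (p x).toReal * info p α x ≤ (p x).toReal * info p β x := by
  by_cases hx : p x = 0
  · simp [hx]
  · refine mul_le_mul_of_nonneg_left (neg_le_neg ?_) ENNReal.toReal_nonneg
    exact Real.log_le_log (toReal_agreeProb_pos p β hx)
      (ENNReal.toReal_mono (agreeProb_ne_top p α x) (agreeProb_anti p h x))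

lemma mul_info_union_add_inter_le (p : PMF (Fin n → ℕ)) (α β : Finset (Fin n))
    (x : Fin n → ℕ) :
    (p x).toReal * info p (α ∪ β) x + (p x).toReal * info p (α ∩ β) x ≤
      (p x).toReal * info p α x + (p x).toReal * info p β x +
        ((p x * ratio p α β x).toReal - (p x).toReal) := by
  by_cases hx : p x = 0
  · simp [hx]
  · have ha := toReal_agreeProb_pos p α hx
    have hb := toReal_agreeProb_pos p β hx
    have hu := toReal_agreeProb_pos p (α ∪ β) hx
    have hi := toReal_agreeProb_pos p (α ∩ β) hx
    have hr : (p x * ratio p α β x).toReal = (p x).toReal *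
        ((agreeProb p α x).toReal * (agreeProb p β x).toReal *
          (agreeProb p (α ∪ β) x).toReal⁻¹ * (agreeProb p (α ∩ β) x).toReal⁻¹) := by
      simp [ratio, ENNReal.toReal_mul, ENNReal.toReal_inv]
    have hlog := Real.log_le_sub_one_of_pos
      (mul_pos (mul_pos (mul_pos ha hb) (inv_pos.2 hu)) (inv_pos.2 hi))
    rw [Real.log_mul (by positivity) (by positivity), Real.log_mul (by positivity) (by positivity),
      Real.log_mul ha.ne' hb.ne', Real.log_inv, Real.log_inv] at hlog
    rw [hr]
    unfold info
    have := mul_le_mul_of_nonneg_left hlog (ENNReal.toReal_nonneg (a := p x))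
    linarith

lemma summable_mul_ratio (p : PMF (Fin n → ℕ)) (α β : Finset (Fin n)) :
    Summable fun x => (p x * ratio p α β x).toReal :=
  ENNReal.summable_toReal ((tsum_mul_ratio_le_one p α β).trans_lt ENNReal.one_lt_top).ne

lemma summable_prob (p : PMF (Fin n → ℕ)) : Summable fun x => (p x).toReal :=
  ENNReal.summable_toReal p.tsum_coe_ne_top

lemma tsum_mul_ratio_sub_le (p : PMF (Fin n → ℕ)) (α β : Finset (Fin n)) :
    ∑' x, ((p x * ratio p α β x).toReal - (p x).toReal) ≤ 0 := by
  rw [(summable_mul_ratio p α β).tsum_sub (summable_prob p),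
    ← ENNReal.tsum_toReal_eq p.apply_ne_top, p.tsum_coe]
  have hne : ∀ x, p x * ratio p α β x ≠ ⊤ := fun x =>
    (((ENNReal.le_tsum x).trans (tsum_mul_ratio_le_one p α β)).trans_lt ENNReal.one_lt_top).ne
  rw [← ENNReal.tsum_toReal_eq hne, sub_nonpos]
  exact ENNReal.toReal_mono ENNReal.one_ne_top (tsum_mul_ratio_le_one p α β)

lemma Hm_eq_tsum_info (p : PMF (Fin n → ℕ)) (α : Finset (Fin n)) :
    Hm p α = ∑' x, (p x).toReal * info p α x := by
  unfold Hm marginal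
  rw [tsum_negMulLog_map, ENNReal.tsum_toReal_eq
    fun x => ENNReal.mul_ne_top (p.apply_ne_top x) ENNReal.ofReal_ne_top]
  refine tsum_congr fun x => ?_
  rw [map_apply_eq_agreeProb p α _ (restrict_eq_iff α), ENNReal.toReal_mul]
  exact congrArg _ (ENNReal.toReal_ofReal (info_nonneg p α x))

lemma FiniteEntropy.summable_singleton {p : PMF (Fin n → ℕ)} (hp : FiniteEntropy p)
    (i : Fin n) : Summable fun x => (p x).toReal * info p {i} x := by
  refine (ENNReal.summable_toReal ((summable_negMulLog_map_iff p _).1 (hp i))).congr fun x => ?_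
  rw [map_apply_eq_agreeProb p {i} (fun x => x i) (by simp), ENNReal.toReal_mul]
  exact congrArg _ (ENNReal.toReal_ofReal (info_nonneg p {i} x))

lemma FiniteEntropy.summable_info {p : PMF (Fin n → ℕ)} (hp : FiniteEntropy p)
    (α : Finset (Fin n)) : Summable fun x => (p x).toReal * info p α x := by
  induction α using Finset.induction_on with
  | empty => simp [info, agreeProb_empty]
  | insert i α _ ih =>
    refine Summable.of_nonneg_of_le
      (fun x => mul_nonneg ENNReal.toReal_nonneg (info_nonneg p _ x)) (fun x => ?_)
      (((hp.summable_singleton i).add ih).add (summable_mul_ratio p {i} α))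
    have h := mul_info_union_add_inter_le p {i} α x
    have h₁ := mul_nonneg (ENNReal.toReal_nonneg (a := p x)) (info_nonneg p ({i} ∩ α) x)
    have h₂ := ENNReal.toReal_nonneg (a := p x)
    rw [← Finset.insert_eq] at h
    linarith

lemma FiniteEntropy.Hm_mono {p : PMF (Fin n → ℕ)} (hp : FiniteEntropy p)
    {α β : Finset (Fin n)} (h : α ⊆ β) : Hm p α ≤ Hm p β := by
  rw [Hm_eq_tsum_info, Hm_eq_tsum_info]
  exact (hp.summable_info α).tsum_le_tsum (mul_info_mono p h) (hp.summable_info β)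

lemma FiniteEntropy.Hm_submod {p : PMF (Fin n → ℕ)} (hp : FiniteEntropy p)
    (α β : Finset (Fin n)) : Hm p (α ∪ β) + Hm p (α ∩ β) ≤ Hm p α + Hm p β := by
  have hαβ := (hp.summable_info α).add (hp.summable_info β)
  have hr := (summable_mul_ratio p α β).sub (summable_prob p)
  have h := ((hp.summable_info (α ∪ β)).add (hp.summable_info (α ∩ β))).tsum_le_tsum
    (mul_info_union_add_inter_le p α β) (hαβ.add hr)
  rw [(hp.summable_info (α ∪ β)).tsum_add (hp.summable_info (α ∩ β)), hαβ.tsum_add hr,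
    (hp.summable_info α).tsum_add (hp.summable_info β)] at h
  simp_rw [Hm_eq_tsum_info]
  linarith [tsum_mul_ratio_sub_le p α β]

lemma FiniteEntropy.isPolymatroid_Hc {p : PMF (Fin n → ℕ)} (hp : FiniteEntropy p)
    (C : Finset (Fin n)) : IsPolymatroid fun Q => Hc p Q C where
  empty := by simp [Hc]
  mono h := sub_le_sub_right (hp.Hm_mono (Finset.union_subset_union_left h)) _
  submod A B := by
    have h := hp.Hm_submod (A ∪ C) (B ∪ C)
    rw [← Finset.union_union_distrib_right, ← Finset.inter_union_distrib_right] at h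
    unfold Hc
    linarith

lemma FiniteEntropy.Hc_anti_right {p : PMF (Fin n → ℕ)} (hp : FiniteEntropy p)
    {C C' : Finset (Fin n)} (h : C ⊆ C') (Q : Finset (Fin n)) : Hc p Q C' ≤ Hc p Q C := by
  have h₁ := hp.Hm_submod (Q ∪ C) C'
  have h₂ := hp.Hm_mono (Finset.subset_inter (Finset.subset_union_right (s₁ := Q)) h)
  rw [Finset.union_assoc, Finset.union_eq_right.2 h] at h₁
  unfold Hc
  linarith

lemma Hc_eq_zero_of_subset (p : PMF (Fin n → ℕ)) {Q C : Finset (Fin n)} (h : Q ⊆ C) :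
    Hc p Q C = 0 := by
  rw [Hc, Finset.union_eq_right.2 h, sub_self]

end Entropy

section CommonBit

/-- The point whose coordinates in `D` are `0` and whose other coordinates are the bit `b`. -/
def bitPoint (D : Finset (Fin n)) (b : Bool) (i : Fin n) : ℕ :=
  if i ∈ D then 0 else b.toNat

/-- The variables in `D` are constant and all the others equal one common fair bit. -/
noncomputable def commonBit (D : Finset (Fin n)) : PMF (Fin n → ℕ) :=
  (PMF.uniformOfFintype Bool).map (bitPoint D)

lemma finiteEntropy_commonBit (D : Finset (Fin n)) : FiniteEntropy (commonBit D) := by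
  intro i
  rw [commonBit, PMF.map_comp, summable_negMulLog_map_iff, tsum_fintype]
  exact ENNReal.sum_ne_top.2 fun b _ =>
    ENNReal.mul_ne_top (PMF.apply_ne_top _ _) ENNReal.ofReal_ne_top

lemma Hm_commonBit (D α : Finset (Fin n)) :
    Hm (commonBit D) α = if α ⊆ D then 0 else Real.log 2 := by
  unfold Hm marginal commonBit
  rw [PMF.map_comp, tsum_negMulLog_map, tsum_fintype]
  simp only [PMF.map_apply, Function.comp_apply, tsum_fintype, Fintype.sum_bool,
    PMF.uniformOfFintype_apply, Fintype.card_bool]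
  have hiff : ((fun i : { i // i ∈ α } => bitPoint D true i.1) =
      fun i => bitPoint D false i.1) ↔ α ⊆ D := by
    rw [funext_iff, Subtype.forall]
    refine forall₂_congr fun i _ => ?_
    by_cases hi : i ∈ D <;> simp [bitPoint, hi]
  have hiff' := eq_comm.trans hiff
  by_cases h : α ⊆ D
  · simp [hiff, hiff', h, ENNReal.inv_two_add_inv_two]
  · simp [hiff, hiff', h, ← two_mul, ← mul_assoc, ENNReal.mul_inv_cancel,
      ENNReal.toReal_ofReal (Real.log_nonneg one_le_two)]

lemma valid_commonBit {D : Finset (Fin n)} {K : CMI n} (h : ¬ K.C ⊆ D) :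
    Valid (commonBit D) K := by
  have h₀ (Q : Finset (Fin n)) : Hc (commonBit D) Q K.C = 0 := by
    rw [Hc, Hm_commonBit, Hm_commonBit, if_neg h,
      if_neg fun h' => h (Finset.subset_union_right.trans h'), sub_self]
  simp [Valid, J, h₀]

lemma not_valid_commonBit {L : CMI n} (h : ¬ Degenerate L) :
    ¬ Valid (commonBit L.C) L := by
  have hcard : 2 ≤ Multiset.card (pur L).Qs := by
    by_contra! hlt
    refine h fun p hp => ?_
    have hg := hp.isPolymatroid_Hc L.C
    have h₁ := hg.defect_filter_sdiff (I := L.C) (Hc_eq_zero_of_subset p le_rfl) L.Qs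
    exact h₁.symm.trans (hg.defect_eq_zero_of_card_le_one (Nat.lt_succ_iff.1 hlt))
  have hfin := finiteEntropy_commonBit L.C
  have hg := hfin.isPolymatroid_Hc L.C
  intro hv
  have h₁ : defect (fun Q => Hc (commonBit L.C) Q L.C) (pur L).Qs = 0 :=
    (hg.defect_filter_sdiff (I := L.C) (Hc_eq_zero_of_subset _ le_rfl) L.Qs).trans hv
  have hHc (Q : Finset (Fin n)) :
      Hc (commonBit L.C) Q L.C = if Q ⊆ L.C then 0 else Real.log 2 := by
    simp [Hc, Hm_commonBit, Finset.union_subset_iff]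
  have hconst : ((pur L).Qs.map fun Q => Hc (commonBit L.C) Q L.C) =
      (pur L).Qs.map fun _ => Real.log 2 := by
    refine Multiset.map_congr rfl fun Q hQ => ?_
    obtain ⟨hQ, hne⟩ := Multiset.mem_filter.1 hQ
    obtain ⟨R, -, rfl⟩ := Multiset.mem_map.1 hQ
    rw [hHc, if_neg]
    intro hsub
    exact hne (Finset.disjoint_self_iff_empty _ |>.1
      (Finset.disjoint_of_subset_right hsub Finset.sdiff_disjoint))
  have hlog : 0 < Real.log 2 := Real.log_pos one_lt_two
  have hle : Hc (commonBit L.C) (pur L).Qs.sup L.C ≤ Real.log 2 := by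
    rw [hHc]
    split_ifs
    exacts [hlog.le, le_rfl]
  rw [defect, hconst, Multiset.map_const', Multiset.sum_replicate, nsmul_eq_mul] at h₁
  have h₂ : (2 : ℝ) ≤ Multiset.card (pur L).Qs := by exact_mod_cast hcard
  nlinarith

lemma Implies.subset {K L : CMI n} (hKL : Implies K L) (hL : ¬ Degenerate L) : K.C ⊆ L.C := by
  by_contra h
  exact not_valid_commonBit hL (hKL _ (finiteEntropy_commonBit _) (valid_commonBit h))

end CommonBit

lemma disjoint_repSet_pur (K : CMI n) : Disjoint K.C (repSet (pur K)) := by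
  rw [Finset.disjoint_left]
  intro q hC hq
  have hq : 2 ≤ Multiset.card ((pur K).Qs.filter fun Q => q ∈ Q) := (Finset.mem_filter.1 hq).2
  obtain ⟨Q, hQ⟩ := Multiset.card_pos_iff_exists_mem.1 (zero_lt_two.trans_le hq)
  obtain ⟨hQ, hqQ⟩ := Multiset.mem_filter.1 hQ
  obtain ⟨R, -, rfl⟩ := Multiset.mem_map.1 (Multiset.mem_filter.1 hQ).1
  exact (Finset.mem_sdiff.1 hqQ).2 hC

lemma RCond_C_subset (K K' : CMI n) : (RCond K K').C ⊆ K'.C := by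
  unfold RCond
  dsimp only
  split_ifs <;> simp

lemma valid_iff_repSet_parts {p : PMF (Fin n → ℕ)} (hp : FiniteEntropy p) (K : CMI n) :
    Valid p K ↔ Hc p (repSet (pur K)) K.C = 0 ∧
      defect (fun Q => Hc p Q K.C) (parts (pur K)) = 0 := by
  have hg := hp.isPolymatroid_Hc K.C
  rw [← hg.defect_eq_zero_iff_parts (pur K)]
  exact (hg.defect_filter_sdiff (I := K.C) (Hc_eq_zero_of_subset p le_rfl) K.Qs).symm ▸ Iff.rfl

/-- If `X_I` is a function of `X_C`, then removing `I` from a conditioning set that contains `C`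
does not change conditional entropies. -/
lemma Hc_sdiff_right {p : PMF (Fin n → ℕ)} (hp : FiniteEntropy p) {C C' I : Finset (Fin n)}
    (hI : Hc p I C = 0) (hdisj : Disjoint C I) (hC : C ⊆ C') (Q : Finset (Fin n)) :
    Hc p Q (C' \ I) = Hc p Q C' := by
  have hC' : C ⊆ C' \ I := Finset.subset_sdiff.2 ⟨hC, hdisj⟩
  have hm (A : Finset (Fin n)) : Hm p (A ∪ C' \ I) = Hm p (A ∪ C') := by
    refine le_antisymm
      (hp.Hm_mono (Finset.union_subset_union_right Finset.sdiff_subset)) ?_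
    have h : Hc p ((A ∪ C') \ I) C = Hc p (A ∪ C') C :=
      (hp.isPolymatroid_Hc C).sdiff_eq hI (A ∪ C')
    have h₁ : (A ∪ C') \ I ∪ C ⊆ A ∪ C' \ I := by
      refine Finset.union_subset ?_ (hC'.trans Finset.subset_union_right)
      rw [Finset.union_sdiff_distrib]
      exact Finset.union_subset_union_left Finset.sdiff_subset
    have h₂ : Hm p (A ∪ C') ≤ Hm p (A ∪ C' ∪ C) := hp.Hm_mono Finset.subset_union_left
    have h₃ := hp.Hm_mono h₁
    unfold Hc at h
    linarith
  have h₀ := hm ∅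
  rw [Finset.empty_union, Finset.empty_union] at h₀
  rw [Hc, Hc, hm, h₀]

lemma valid_iff_valid_RCond {p : PMF (Fin n → ℕ)} (hp : FiniteEntropy p) {K K' : CMI n}
    (hC : K.C ⊆ K'.C) (hK : Valid p K) : Valid p K' ↔ Valid p (RCond K K') := by
  have hI := ((valid_iff_repSet_parts hp K).1 hK).1
  have hcond := Hc_sdiff_right hp hI (disjoint_repSet_pur K) hC
  have hJ (Qs : Multiset (Finset (Fin n))) :
      J p (K'.C \ repSet (pur K)) Qs = defect (fun Q => Hc p Q K'.C) Qs := by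
    simp only [J, defect, hcond]
  have hg := hp.isPolymatroid_Hc K'.C
  have hI' : Hc p (repSet (pur K)) K'.C = 0 := by
    have h := hp.Hc_anti_right hC (repSet (pur K))
    exact le_antisymm (h.trans hI.le) (hg.nonneg _)
  rw [valid_iff_repSet_parts hp K', ← hg.defect_canParts (pur K'),
    ← hg.defect_filter_sdiff hI', ← hg.sdiff_eq hI' (repSet (pur K'))]
  unfold RCond
  dsimp only
  split_ifs with h₁ h₂ h₃
  · rw [h₁.1, hg.empty, hg.defect_eq_zero_of_card_le_one h₁.2]
    simp [Valid, J, Hc]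
  · rw [Valid, hJ, h₂, hg.empty]
    simp
  · rw [Valid, hJ, hg.defect_eq_zero_of_card_le_one h₃]
    simp [defect]
  · rw [Valid, hJ, hg.defect_cons_cons_eq_zero_iff]


/-- (1) if `R_K^{K'} = (·,⟨⟩)` then `K` implies `K'` iff `C ⊆ C'`;
(2) if `R_K^{K'} ≠ (·,⟨⟩)` then `K` implies `K'` iff `K` implies `R_K^{K'}`. -/
theorem stmt14 {n : ℕ} (K K' : CMI n)
    (hdK : ¬ Degenerate K) (hdK' : ¬ Degenerate K') :
    (Degenerate (RCond K K') → (Implies K K' ↔ K.C ⊆ K'.C)) ∧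
    (¬ Degenerate (RCond K K') → (Implies K K' ↔ Implies K (RCond K K'))) := by
  refine ⟨fun hR => ⟨fun h => h.subset hdK', fun hC p hp hK => ?_⟩,
    fun hR => ⟨fun h p hp hK => ?_, fun h p hp hK => ?_⟩⟩
  · exact (valid_iff_valid_RCond hp hC hK).2 (hR p hp)
  · exact (valid_iff_valid_RCond hp (h.subset hdK') hK).1 (h p hp hK)
  · exact (valid_iff_valid_RCond hp ((h.subset hR).trans (RCond_C_subset K K')) hK).2 (h p hp hK)

end Paper
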